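/- Consider the pendulum ẋ = y, ẏ = g(x) with g = G′, G a polynomial of degree m+1 ≥ 3 with leading coefficient G₀ ≠ 0, on its zero-energy level y² = 2G(x). Let a ∈ ℂ satisfy a^{m−1} = 2G₀. Then there exist holomorphic functions v(θ) and t(θ) on a neighborhood of θ = 0 with expansions v(θ) = a·θ^{m+1}·(1 + O(θ)) and t(θ) = −(2/(m−1))·θ^{m−1}·(1 + O(θ)), such that, setting w(θ) := θ^{m−1}, x(θ) := w(θ)/v(θ), y(θ) := 1/v(θ), the curve θ ↦ (x(θ), y(θ)) is a zero-energy solution of the pendulum in the time t(θ): for all small θ ≠ 0, dx/dθ = (dt/dθ)·y(θ) and dy/dθ = (dt/dθ)·g(x(θ)). Consequently every small circle γ^θ around θ = 0 defines a discrepancy-free blow-up loop (γ^t, γ^{vw}) around blow-up time T = 0 and (v,w) = (0,0): for even m the loop first closes after one cycle of θ, with winding numbers 𝔴(γ^t,0) = m−1 = 𝔴(γ^w,0) and 𝔴(γ^v,0) = m+1; for odd m there are two leaves ±v(θ), and on each leaf half a cycle of θ closes the loop, with half these winding numbers. -/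

import Mathlib

open Metric

/-- Winding number (as a complex number) of a differentiable closed path
`γ : [0,1] → ℂ` around a point `p`. -/
noncomputable def wnd (γ : ℝ → ℂ) (p : ℂ) : ℂ :=
  (2 * (Real.pi : ℂ) * Complex.I)⁻¹ * ∫ s in (0:ℝ)..1, deriv γ s / (γ s - p)

open Filter Topology

lemma lemA (n : ℕ) (R : Polynomial ℂ) (a : ℂ) (ha0 : a ≠ 0)
    (ha : a ^ (n + 1) = 2 * R.eval 0) :
    ∃ u ψ : ℂ → ℂ, AnalyticAt ℂ u 0 ∧ u 0 = 1 ∧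
      (∀ᶠ τ in 𝓝 (0:ℂ), a ^ (n + 1) * u τ ^ (n + 1) = 2 * R.eval (a * (τ * u τ))) ∧
      (∀ᶠ τ in 𝓝 (0:ℂ), ψ (τ * u τ) = τ) := by
  have han : a ^ (n + 1) ≠ 0 := pow_ne_zero _ ha0
  set h : ℂ → ℂ := fun z => 2 * R.eval (a * z) / a ^ (n + 1) with hh
  have hdiff : Differentiable ℂ h := by
    have := R.differentiable
    intro z
    have h1 : DifferentiableAt ℂ (fun z => R.eval (a * z)) z :=
      (this (a * z)).comp z (by fun_prop)
    exact (h1.const_mul 2).div_const _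
  have hana : AnalyticAt ℂ h 0 := hdiff.analyticAt 0
  have h0 : h 0 = 1 := by
    simp only [hh, mul_zero, ← ha]
    exact div_self han
  set k : ℂ → ℂ := fun z => Complex.exp (Complex.log (h z) / (n + 1)) with hk
  have hkana : AnalyticAt ℂ k 0 := by
    have : AnalyticAt ℂ (fun z => Complex.log (h z)) 0 :=
      hana.clog (by rw [h0]; exact Complex.one_mem_slitPlane)
    exact (this.div_const).cexp
  have hk0 : k 0 = 1 := by simp [hk, h0]
  have hkne : ∀ z, k z ≠ 0 := fun z => Complex.exp_ne_zero _
  have hkpow : ∀ᶠ z in 𝓝 (0:ℂ), k z ^ (n + 1) = h z := by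
    have : ∀ᶠ z in 𝓝 (0:ℂ), h z ≠ 0 := hana.continuousAt.eventually_ne (by simp [h0])
    filter_upwards [this] with z hz
    simp only [hk]
    rw [← Complex.exp_nat_mul]
    have : ((n + 1 : ℕ) : ℂ) * (Complex.log (h z) / (n + 1)) = Complex.log (h z) := by
      have : (n : ℂ) + 1 ≠ 0 := by exact_mod_cast n.succ_ne_zero
      push_cast
      field_simp
    rw [this, Complex.exp_log hz]
  set p : ℂ → ℂ := fun z => z / k z with hp
  have hpana : AnalyticAt ℂ p 0 := analyticAt_id.div hkana (hkne 0)
  have hp0 : p 0 = 0 := by simp [hp]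
  have hpd : deriv p 0 ≠ 0 := by
    have : HasDerivAt p ((1 * k 0 - 0 * deriv k 0) / k 0 ^ 2) 0 :=
      (hasDerivAt_id (0:ℂ)).div hkana.differentiableAt.hasDerivAt (hkne 0)
    rw [this.deriv, hk0]; simp
  set φ := hpana.hasStrictDerivAt.localInverse _ _ _ hpd with hφ
  have hφana : AnalyticAt ℂ φ 0 := by
    have := hpana.analyticAt_localInverse hpd
    rwa [hp0] at this
  have hφ0 : φ 0 = 0 := by
    have : φ (p 0) = 0 := HasStrictFDerivAt.localInverse_apply_image ..
    rwa [hp0] at this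
  have hr : ∀ᶠ τ in 𝓝 (0:ℂ), p (φ τ) = τ := by
    have : ∀ᶠ τ in 𝓝 (p 0), p (φ τ) = τ := HasStrictDerivAt.eventually_right_inverse ..
    rwa [hp0] at this
  have hmul : ∀ τ, p (φ τ) = τ → τ * k (φ τ) = φ τ := by
    intro τ h
    have h' : φ τ / k (φ τ) = τ := h
    rw [div_eq_iff (hkne _)] at h'
    exact h'.symm
  have hkpow' : ∀ᶠ τ in 𝓝 (0:ℂ), k (φ τ) ^ (n + 1) = h (φ τ) := by
    have : Tendsto φ (𝓝 0) (𝓝 0) := by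
      have := hφana.continuousAt.tendsto
      rwa [hφ0] at this
    exact this.eventually hkpow
  refine ⟨fun τ => k (φ τ), p, ?_, by simp [hφ0, hk0], ?_, ?_⟩
  · exact AnalyticAt.fun_comp (by rwa [hφ0]) hφana
  · filter_upwards [hr, hkpow'] with τ h1 h2
    rw [hmul τ h1, h2]
    simp only [hh]
    field_simp
  · filter_upwards [hr] with τ h1
    rw [hmul τ h1, h1]

lemma lemB (n : ℕ) (f : ℂ → ℂ) (hf : AnalyticAt ℂ f 0) (hf0 : f 0 = 1) :
    ∃ e : ℂ → ℂ, AnalyticAt ℂ e 0 ∧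
      ∀ᶠ z in 𝓝 (0:ℂ), (n + 1) * e z + z * deriv e z = f z := by
  obtain ⟨r, hr, hfr⟩ := Metric.eventually_nhds_iff_ball.1 hf.eventually_analyticAt
  have hd : DifferentiableOn ℂ (fun z => z ^ n * f z) (ball 0 r) := fun z hz =>
    ((differentiableAt_pow n).mul (hfr z hz).differentiableAt).differentiableWithinAt
  obtain ⟨P, hP⟩ := hd.isExactOn_ball.with_val_at 0 0
  obtain ⟨hP0, hP⟩ := hP
  have hPana : AnalyticAt ℂ P 0 := by
    have : DifferentiableOn ℂ P (ball 0 r) := fun z hz =>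
      (hP z hz).differentiableAt.differentiableWithinAt
    exact this.analyticAt (ball_mem_nhds 0 hr)
  have hPd : deriv P =ᶠ[𝓝 0] fun z => z ^ n * f z := by
    filter_upwards [ball_mem_nhds 0 hr] with z hz using (hP z hz).deriv
  have hord : analyticOrderAt (deriv P) 0 = n := by
    rw [hPana.deriv.analyticOrderAt_eq_natCast]
    refine ⟨f, hf, by simp [hf0], ?_⟩
    filter_upwards [hPd] with z hz
    simp [hz]
  have htop : analyticOrderAt P 0 ≠ ⊤ := by
    intro h
    rw [analyticOrderAt_eq_top] at h
    have h' : P =ᶠ[𝓝 0] fun _ => 0 := h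
    have h2 := h'.deriv
    have : analyticOrderAt (deriv P) 0 = ⊤ := by
      rw [analyticOrderAt_eq_top]
      filter_upwards [h2] with z hz
      simp [hz]
    rw [this] at hord
    exact ENat.top_ne_natCast n hord
  obtain ⟨g, hg, hg0, hPg⟩ := hPana.analyticOrderAt_ne_top.1 htop
  set k := analyticOrderNatAt P 0 with hk
  have hk0 : k ≠ 0 := by
    intro h0
    have := hPg.self_of_nhds
    rw [h0, hP0] at this
    simp at this
    exact hg0 this.symm
  obtain ⟨j, hj⟩ := Nat.exists_eq_succ_of_ne_zero hk0
  have hder : deriv P =ᶠ[𝓝 0] fun z => z ^ j * ((j + 1) * g z + z * deriv g z) := by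
    have h1 : P =ᶠ[𝓝 0] fun z => z ^ (j + 1) * g z := by
      filter_upwards [hPg] with z hz
      simp [hz, hj]
    filter_upwards [h1.deriv, hg.eventually_analyticAt] with z hz hgz
    rw [hz]
    have := (hasDerivAt_pow (j + 1) z).mul hgz.differentiableAt.hasDerivAt
    have h2 : HasDerivAt (fun z => z ^ (j + 1) * g z) _ z := this
    rw [h2.deriv]
    push_cast
    try simp only [Nat.add_sub_cancel]
    ring
  have hsana : AnalyticAt ℂ (fun z => ((j:ℂ) + 1) * g z + z * deriv g z) 0 :=
    (analyticAt_const.mul hg).add (analyticAt_id.mul hg.deriv)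
  have hjn : j = n := by
    have : analyticOrderAt (deriv P) 0 = j := by
      rw [hPana.deriv.analyticOrderAt_eq_natCast]
      refine ⟨_, hsana, ?_, ?_⟩
      · simp only [zero_mul, add_zero]
        exact mul_ne_zero (by exact_mod_cast j.succ_ne_zero) hg0
      · filter_upwards [hder] with z hz
        simp [hz]
    rw [this] at hord
    exact_mod_cast hord
  subst hjn
  refine ⟨g, hg, ?_⟩
  have hpunct : (fun z => ((j:ℂ) + 1) * g z + z * deriv g z) =ᶠ[𝓝[≠] 0] f := by
    filter_upwards [hder.filter_mono nhdsWithin_le_nhds, hPd.filter_mono nhdsWithin_le_nhds,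
      self_mem_nhdsWithin] with z h1 h2 h3
    rw [h2] at h1
    exact (mul_left_cancel₀ (pow_ne_zero _ h3) h1).symm
  exact (hsana.frequently_eq_iff_eventually_eq hf).1 hpunct.frequently

lemma lemB' (n : ℕ) (f : ℂ → ℂ) (hf : AnalyticAt ℂ f 0) (hf0 : f 0 = 1)
    (hev : ∀ᶠ z in 𝓝 (0:ℂ), f (-z) = f z) :
    ∃ E : ℂ → ℂ, AnalyticAt ℂ E 0 ∧ E 0 = 1 ∧ (∀ z, E (-z) = E z) ∧
      ∀ᶠ z in 𝓝 (0:ℂ), (n + 1) * E z + z * deriv E z = (n + 1) * f z := by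
  obtain ⟨e, he, hode⟩ := lemB n f hf hf0
  have hn : (n : ℂ) + 1 ≠ 0 := by exact_mod_cast n.succ_ne_zero
  have hneg : Tendsto (fun z : ℂ => -z) (𝓝 0) (𝓝 0) := by
    simpa using (continuous_neg (G := ℂ)).tendsto 0
  have hena : AnalyticAt ℂ (fun z => e (-z)) 0 :=
    AnalyticAt.fun_comp (by simpa using he) (analyticAt_id.neg)
  refine ⟨fun z => ((n:ℂ) + 1) / 2 * (e z + e (-z)), analyticAt_const.mul (he.add hena), ?_, ?_, ?_⟩
  · have := hode.self_of_nhds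
    simp only [zero_mul, add_zero, hf0] at this
    simp only [neg_zero]
    linear_combination this
  · intro z
    simp only [neg_neg]
    ring
  · filter_upwards [hode, hneg.eventually hode, hev, he.eventually_analyticAt,
      hneg.eventually he.eventually_analyticAt] with z h1 h2 h3 h4 h5
    have d1 := h4.differentiableAt.hasDerivAt
    have d2 : HasDerivAt (fun z => e (-z)) (deriv e (-z) * (-1)) z :=
      h5.differentiableAt.hasDerivAt.comp z (hasDerivAt_neg z)
    have d3 : HasDerivAt (fun z => ((n:ℂ) + 1) / 2 * (e z + e (-z))) _ z :=
      (d1.add d2).const_mul (((n:ℂ) + 1) / 2)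
    rw [d3.deriv]
    linear_combination ((n:ℂ) + 1) / 2 * (h1 + h2 + h3)

lemma wnd_aux (k : ℕ) (c : ℂ) (hc : c ≠ 0) (F h : ℂ → ℂ) (r : ℝ)
    (hh : DifferentiableOn ℂ h (ball 0 r)) (hs : ∀ z ∈ ball (0:ℂ) r, h z ∈ Complex.slitPlane)
    (hF : ∀ z ∈ ball (0:ℂ) r, F z = c * z ^ k * h z) (κ : ℂ) (hκ : κ.re = 0)
    (ε : ℝ) (h0 : 0 < ε) (hr : ε < r) (hper : h (ε * Complex.exp κ) = h ε) :
    wnd (fun s : ℝ => F ((ε : ℂ) * Complex.exp (κ * (s : ℂ)))) 0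
      = (2 * (Real.pi : ℂ) * Complex.I)⁻¹ * (k * κ) := by
  unfold wnd
  congr 1
  set γ : ℝ → ℂ := fun s => (ε : ℂ) * Complex.exp (κ * (s : ℂ)) with hγ
  have hmem : ∀ s, γ s ∈ ball (0:ℂ) r := by
    intro s
    rw [mem_ball_zero_iff]
    simp only [hγ, norm_mul, Complex.norm_exp, Complex.norm_real, Complex.mul_re, hκ,
      Complex.ofReal_im]
    simp [abs_of_pos h0, hr]
  have hne : ∀ s, γ s ≠ 0 := fun s =>
    mul_ne_zero (by exact_mod_cast h0.ne') (Complex.exp_ne_zero _)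
  have hγd : ∀ s, HasDerivAt γ (κ * γ s) s := by
    intro s
    have h1 : HasDerivAt (fun s : ℝ => κ * (s : ℂ)) (κ * 1) s :=
      (Complex.ofRealCLM.hasDerivAt (x := s)).const_mul κ
    have := (h1.cexp).const_mul (ε : ℂ)
    refine HasDerivAt.congr_deriv (f := γ) this ?_
    change _ = κ * ((ε : ℂ) * Complex.exp (κ * (s : ℂ)))
    ring
  have hγc : Continuous γ := by
    rw [continuous_iff_continuousAt]; exact fun s => (hγd s).continuousAt
  have hhd : ∀ z ∈ ball (0:ℂ) r, HasDerivAt h (deriv h z) z := fun z hz =>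
    (hh.differentiableAt (isOpen_ball.mem_nhds hz)).hasDerivAt
  have hhγ : ∀ s, HasDerivAt (fun s => h (γ s)) (deriv h (γ s) * (κ * γ s)) s := fun s =>
    HasDerivAt.comp (𝕜' := ℂ) s (hhd _ (hmem s)) (hγd s)
  have hhne : ∀ s, h (γ s) ≠ 0 := fun s => Complex.slitPlane_ne_zero (hs _ (hmem s))
  have hD : ∀ s : ℝ, deriv (fun s => F (γ s)) s / (F (γ s) - 0)
      = k * κ + deriv h (γ s) * (κ * γ s) / h (γ s) := by
    intro s
    have e1 : (fun s => F (γ s)) = fun s => c * γ s ^ k * h (γ s) :=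
      funext fun s => hF _ (hmem s)
    have d1 : HasDerivAt (fun s => c * γ s ^ k * h (γ s)) _ s :=
      (((hγd s).pow k).const_mul c).mul (hhγ s)
    rw [e1, hF _ (hmem s), d1.deriv]
    have a1 := hne s
    have a2 := hhne s
    rcases k with _ | k
    · simp
      field_simp
    · simp only [Nat.add_sub_cancel, sub_zero, Pi.pow_apply]
      field_simp
      ring
  refine (intervalIntegral.integral_congr (fun s _ => hD s)).trans ?_
  have hcont : Continuous fun s => (k * κ + deriv h (γ s) * (κ * γ s) / h (γ s) : ℂ) := by
    have c1 : Continuous fun s => deriv h (γ s) := by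
      rw [continuous_iff_continuousAt]
      intro s
      have := (hh.analyticAt (isOpen_ball.mem_nhds (hmem s))).deriv.continuousAt
      exact this.comp hγc.continuousAt
    have c2 : Continuous fun s => h (γ s) := by
      rw [continuous_iff_continuousAt]; exact fun s => (hhγ s).continuousAt
    exact continuous_const.add ((c1.mul (continuous_const.mul hγc)).div c2 hhne)
  have hL : ∀ s : ℝ, HasDerivAt (fun s : ℝ => k * κ * (s:ℂ) + Complex.log (h (γ s)))
      (k * κ + deriv h (γ s) * (κ * γ s) / h (γ s)) s := by
    intro s
    have h1 : HasDerivAt (fun s : ℝ => k * κ * (s : ℂ)) (k * κ * 1) s :=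
      (Complex.ofRealCLM.hasDerivAt (x := s)).const_mul (k * κ)
    have := h1.add ((hhγ s).clog_real (hs _ (hmem s)))
    have h2 : HasDerivAt (fun s : ℝ => k * κ * (s:ℂ) + Complex.log (h (γ s))) _ s := this
    refine h2.congr_deriv ?_
    rw [mul_one]
  rw [intervalIntegral.integral_eq_sub_of_hasDerivAt (fun s _ => hL s)
    (hcont.intervalIntegrable _ _)]
  simp [hγ, hper]

/-- regularization of the pendulum `ẋ = y, ẏ = g(x)`, `g = G′`,
at its totally degenerate blow-up point `(v,w) = (0,0)`: with `w = θ^{m−1}`,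
`v = a·θ^{m+1}(1+O(θ))`, `t = −(2/(m−1))·θ^{m−1}(1+O(θ))`, the curve
`(x,y) = (w/v, 1/v)` is a zero-energy solution in the time `t(θ)`; small
circles in `θ` define discrepancy-free blow-up loops with winding numbers
`𝔴_t = m−1 = 𝔴_w`, `𝔴_v = m+1` (halved, on each of the two leaves, for odd `m`). -/
theorem pendulum_blowup_loop
    (m : ℕ) (hm : 2 ≤ m) (G : Polynomial ℂ)
    (hdeg : G.natDegree = m + 1) (hG₀ : G.coeff (m + 1) ≠ 0)
    (a : ℂ) (ha : a ^ (m - 1) = 2 * G.coeff (m + 1)) :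
    ∃ (r : ℝ) (v t Ev Et : ℂ → ℂ), 0 < r ∧
      DifferentiableOn ℂ v (ball 0 r) ∧ DifferentiableOn ℂ t (ball 0 r) ∧
      DifferentiableOn ℂ Ev (ball 0 r) ∧ DifferentiableOn ℂ Et (ball 0 r) ∧
      -- expansions
      (∀ θ ∈ ball (0:ℂ) r,
        v θ = a * θ ^ (m + 1) * (1 + θ * Ev θ) ∧
        t θ = -(2 / ((m : ℂ) - 1)) * θ ^ (m - 1) * (1 + θ * Et θ)) ∧
      -- zero-energy solution of the pendulum in the time t(θ)
      (∀ θ ∈ ball (0:ℂ) r, θ ≠ 0 →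
        v θ ≠ 0 ∧ t θ ≠ 0 ∧
        (1 / v θ) ^ 2 = 2 * G.eval (θ ^ (m - 1) / v θ) ∧
        HasDerivAt (fun σ : ℂ => σ ^ (m - 1) / v σ) (deriv t θ * (1 / v θ)) θ ∧
        HasDerivAt (fun σ : ℂ => 1 / v σ)
          (deriv t θ * G.derivative.eval (θ ^ (m - 1) / v θ)) θ) ∧
      -- winding numbers of the blow-up loop over a full circle in θ
      (∀ ε : ℝ, 0 < ε → ε < r →
        wnd (fun s : ℝ => t ((ε : ℂ) * Complex.exp (2 * (Real.pi : ℂ) * Complex.I * (s : ℂ)))) 0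
          = (m : ℂ) - 1 ∧
        wnd (fun s : ℝ => ((ε : ℂ) * Complex.exp (2 * (Real.pi : ℂ) * Complex.I * (s : ℂ))) ^ (m - 1)) 0
          = (m : ℂ) - 1 ∧
        wnd (fun s : ℝ => v ((ε : ℂ) * Complex.exp (2 * (Real.pi : ℂ) * Complex.I * (s : ℂ)))) 0
          = (m : ℂ) + 1) ∧
      -- for even m the loop first closes after one full cycle of θ
      (Even m → ∀ ε : ℝ, 0 < ε → ε < r →
        Set.InjOn (fun s : ℝ =>
          (v ((ε : ℂ) * Complex.exp (2 * (Real.pi : ℂ) * Complex.I * (s : ℂ))),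
           ((ε : ℂ) * Complex.exp (2 * (Real.pi : ℂ) * Complex.I * (s : ℂ))) ^ (m - 1)))
          (Set.Ico (0:ℝ) 1)) ∧
      -- for odd m, v and t are even in θ: on each of the two leaves ±v, half a
      -- cycle of θ already closes the loop, with half the winding numbers
      (Odd m →
        (∀ θ ∈ ball (0:ℂ) r, v (-θ) = v θ ∧ t (-θ) = t θ) ∧
        ∀ ε : ℝ, 0 < ε → ε < r →
          wnd (fun s : ℝ => t ((ε : ℂ) * Complex.exp ((Real.pi : ℂ) * Complex.I * (s : ℂ)))) 0
            = ((m : ℂ) - 1) / 2 ∧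
          wnd (fun s : ℝ => ((ε : ℂ) * Complex.exp ((Real.pi : ℂ) * Complex.I * (s : ℂ))) ^ (m - 1)) 0
            = ((m : ℂ) - 1) / 2 ∧
          wnd (fun s : ℝ => v ((ε : ℂ) * Complex.exp ((Real.pi : ℂ) * Complex.I * (s : ℂ)))) 0
            = ((m : ℂ) + 1) / 2) := by
  obtain ⟨n, rfl⟩ : ∃ n, m = n + 2 := ⟨m - 2, by omega⟩
  have e1 : n + 2 - 1 = n + 1 := by omega
  have e2 : n + 2 + 1 = n + 3 := by omega
  have c1 : ((n + 2 : ℕ) : ℂ) - 1 = n + 1 := by push_cast; ring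
  have c2 : ((n + 2 : ℕ) : ℂ) + 1 = n + 3 := by push_cast; ring
  rw [e2] at hdeg hG₀ ha
  rw [e1] at ha
  simp only [e1, e2, c1, c2]
  have hn : (n : ℂ) + 1 ≠ 0 := by exact_mod_cast n.succ_ne_zero
  have ha0 : a ≠ 0 := by
    rintro rfl
    rw [zero_pow (Nat.succ_ne_zero n)] at ha
    exact hG₀ (by simpa using ha.symm)
  have hR0 : G.reverse.eval 0 = G.coeff (n + 3) := by
    rw [← Polynomial.coeff_zero_eq_eval_zero, Polynomial.coeff_zero_reverse,
      Polynomial.leadingCoeff, hdeg]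
  obtain ⟨u, ψ, hu, hu0, huE, huψ⟩ := lemA n G.reverse a ha0 (by rw [hR0, ha])
  have hsq : Tendsto (fun z : ℂ => z ^ 2) (𝓝 0) (𝓝 0) := by
    simpa using (continuous_pow (M := ℂ) 2).tendsto 0
  have hsqa : AnalyticAt ℂ (fun z : ℂ => z ^ 2) 0 := analyticAt_id.pow 2
  have hU : AnalyticAt ℂ (fun z : ℂ => u (z ^ 2)) 0 :=
    AnalyticAt.fun_comp (by simpa using hu) hsqa
  have hdU : AnalyticAt ℂ (fun z : ℂ => deriv u (z ^ 2)) 0 :=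
    AnalyticAt.fun_comp (by simpa using hu.deriv) hsqa
  obtain ⟨E, hE, hE0, hEev, hEode⟩ := lemB' n
    (fun z => 1 + z ^ 2 * deriv u (z ^ 2) / u (z ^ 2))
    (analyticAt_const.add ((hsqa.mul hdU).div hU (by simp [hu0]))) (by simp)
    (by simp)
  set U : ℂ → ℂ := fun z => u (z ^ 2) with hUdef
  have hU0 : U 0 = 1 := by simp [hUdef, hu0]
  have hUsl : ∀ᶠ z in 𝓝 (0:ℂ), U z ∈ Complex.slitPlane :=
    hU.continuousAt.eventually_mem
      (Complex.isOpen_slitPlane.mem_nhds (by rw [hU0]; exact Complex.one_mem_slitPlane))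
  have hEsl : ∀ᶠ z in 𝓝 (0:ℂ), E z ∈ Complex.slitPlane :=
    hE.continuousAt.eventually_mem
      (Complex.isOpen_slitPlane.mem_nhds (by rw [hE0]; exact Complex.one_mem_slitPlane))
  have hall := hU.eventually_analyticAt.and (hE.eventually_analyticAt.and
    ((hsq.eventually hu.eventually_analyticAt).and (hUsl.and (hEsl.and
    ((hsq.eventually huE).and ((hsq.eventually huψ).and hEode))))))
  obtain ⟨r, hr, hall⟩ := Metric.eventually_nhds_iff_ball.1 hall
  have kU : ∀ z ∈ ball (0:ℂ) r, DifferentiableAt ℂ U z := fun z hz => (hall z hz).1.differentiableAt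
  have kE : ∀ z ∈ ball (0:ℂ) r, DifferentiableAt ℂ E z := fun z hz => (hall z hz).2.1.differentiableAt
  have ku : ∀ z ∈ ball (0:ℂ) r, DifferentiableAt ℂ u (z ^ 2) :=
    fun z hz => (hall z hz).2.2.1.differentiableAt
  have kUs : ∀ z ∈ ball (0:ℂ) r, U z ∈ Complex.slitPlane := fun z hz => (hall z hz).2.2.2.1
  have kEs : ∀ z ∈ ball (0:ℂ) r, E z ∈ Complex.slitPlane := fun z hz => (hall z hz).2.2.2.2.1
  have ken : ∀ z ∈ ball (0:ℂ) r,
      a ^ (n + 1) * U z ^ (n + 1) = 2 * G.reverse.eval (a * (z ^ 2 * U z)) :=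
    fun z hz => (hall z hz).2.2.2.2.2.1
  have kψ : ∀ z ∈ ball (0:ℂ) r, ψ (z ^ 2 * U z) = z ^ 2 :=
    fun z hz => (hall z hz).2.2.2.2.2.2.1
  have kode : ∀ z ∈ ball (0:ℂ) r, (n + 1) * E z + z * deriv E z
      = (n + 1) * (1 + z ^ 2 * deriv u (z ^ 2) / U z) :=
    fun z hz => (hall z hz).2.2.2.2.2.2.2
  clear hall
  have kUne : ∀ z ∈ ball (0:ℂ) r, U z ≠ 0 := fun z hz => Complex.slitPlane_ne_zero (kUs z hz)
  have kEne : ∀ z ∈ ball (0:ℂ) r, E z ≠ 0 := fun z hz => Complex.slitPlane_ne_zero (kEs z hz)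
  have kUo : DifferentiableOn ℂ U (ball 0 r) := fun z hz => (kU z hz).differentiableWithinAt
  have kEo : DifferentiableOn ℂ E (ball 0 r) := fun z hz => (kE z hz).differentiableWithinAt
  have hUev : ∀ z, U (-z) = U z := fun z => by simp [hUdef]
  set v : ℂ → ℂ := fun z => a * z ^ (n + 3) * U z with hv
  set t : ℂ → ℂ := fun z => -(2 / ((n : ℂ) + 1)) * z ^ (n + 1) * E z with ht
  have hUd : ∀ z ∈ ball (0:ℂ) r, HasDerivAt U (deriv u (z ^ 2) * (2 * z)) z := by
    intro z hz
    have := (ku z hz).hasDerivAt.comp z (hasDerivAt_pow 2 z)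
    have h' : HasDerivAt U _ z := this
    refine h'.congr_deriv ?_
    simp
  have hvd : ∀ z ∈ ball (0:ℂ) r, HasDerivAt v
      (a * ((n + 3) * z ^ (n + 2)) * U z + a * z ^ (n + 3) * (deriv u (z ^ 2) * (2 * z))) z := by
    intro z hz
    have := ((hasDerivAt_pow (n + 3) z).const_mul a).mul (hUd z hz)
    have h' : HasDerivAt v _ z := this
    simpa using h'
  have htd : ∀ z ∈ ball (0:ℂ) r, HasDerivAt t
      (-2 * z ^ n * (1 + z ^ 2 * deriv u (z ^ 2) / U z)) z := by
    intro z hz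
    have := ((hasDerivAt_pow (n + 1) z).const_mul (-(2 / ((n : ℂ) + 1)))).mul (kE z hz).hasDerivAt
    have h' : HasDerivAt t _ z := this
    refine h'.congr_deriv ?_
    have := kode z hz
    have h2 : 1 + z ^ 2 * deriv u (z ^ 2) / U z
        = ((n + 1) * E z + z * deriv E z) / (n + 1) := by
      rw [this]; field_simp
    rw [h2]
    push_cast
    try simp only [Nat.add_sub_cancel]
    field_simp
    ring
  have hvne : ∀ z ∈ ball (0:ℂ) r, z ≠ 0 → v z ≠ 0 := fun z hz h0 =>
    mul_ne_zero (mul_ne_zero ha0 (pow_ne_zero _ h0)) (kUne z hz)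
  have htne : ∀ z ∈ ball (0:ℂ) r, z ≠ 0 → t z ≠ 0 := fun z hz h0 =>
    mul_ne_zero (mul_ne_zero (neg_ne_zero.2 (div_ne_zero two_ne_zero hn))
      (pow_ne_zero _ h0)) (kEne z hz)
  have henergy : ∀ z ∈ ball (0:ℂ) r, z ≠ 0 →
      (1 / v z) ^ 2 = 2 * G.eval (z ^ (n + 1) / v z) := by
    intro z hz h0
    have hUz := kUne z hz
    have hx : z ^ (n + 1) / v z = (a * (z ^ 2 * U z))⁻¹ := by
      simp only [hv]
      field_simp
      ring
    have hzne : a * (z ^ 2 * U z) ≠ 0 :=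
      mul_ne_zero ha0 (mul_ne_zero (pow_ne_zero _ h0) hUz)
    let _ : Invertible (a * (z ^ 2 * U z))⁻¹ := invertibleOfNonzero (inv_ne_zero hzne)
    have key := Polynomial.eval₂_reverse_mul_pow (RingHom.id ℂ) (a * (z ^ 2 * U z))⁻¹ G
    rw [invOf_eq_inv, inv_inv, hdeg] at key
    have key' : G.reverse.eval (a * (z ^ 2 * U z)) * (a * (z ^ 2 * U z))⁻¹ ^ (n + 3)
      = G.eval (a * (z ^ 2 * U z))⁻¹ := key
    rw [hx, ← key', ← mul_assoc, ← ken z hz, inv_pow, mul_pow, mul_pow, ← pow_mul]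
    simp only [hv]
    field_simp
    ring
  have hxd : ∀ z ∈ ball (0:ℂ) r, z ≠ 0 →
      HasDerivAt (fun σ : ℂ => σ ^ (n + 1) / v σ) (deriv t z * (1 / v z)) z := by
    intro z hz h0
    have hUz := kUne z hz
    have := (hasDerivAt_pow (n + 1) z).div (hvd z hz) (hvne z hz h0)
    have h' : HasDerivAt (fun σ : ℂ => σ ^ (n + 1) / v σ) _ z := this
    refine h'.congr_deriv ?_
    rw [(htd z hz).deriv]
    simp only [hv]
    push_cast
    try simp only [Nat.add_sub_cancel]
    field_simp
    ring
  have hyd : ∀ z ∈ ball (0:ℂ) r, z ≠ 0 → HasDerivAt (fun σ : ℂ => 1 / v σ)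
          (deriv t z * G.derivative.eval (z ^ (n + 1) / v z)) z := by
    intro z hz h0
    have hvz := hvne z hz h0
    have hy : HasDerivAt (fun σ : ℂ => 1 / v σ) (deriv (fun σ : ℂ => 1 / v σ) z) z :=
      ((differentiableAt_const 1).div (hvd z hz).differentiableAt hvz).hasDerivAt
    have h1 : HasDerivAt (fun σ => (1 / v σ) ^ 2) _ z := hy.pow 2
    have h2 : HasDerivAt (fun σ => 2 * G.eval (σ ^ (n + 1) / v σ)) _ z :=
      (HasDerivAt.comp (h₂ := fun w => G.eval w) z (G.hasDerivAt (z ^ (n + 1) / v z))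
        (hxd z hz h0)).const_mul 2
    have hev : (fun σ => 2 * G.eval (σ ^ (n + 1) / v σ)) =ᶠ[𝓝 z] fun σ => (1 / v σ) ^ 2 := by
      filter_upwards [isOpen_ball.mem_nhds hz, isOpen_ne.mem_nhds h0] with σ s1 s2
      exact (henergy σ s1 s2).symm
    have h3 := h1.unique (h2.congr_of_eventuallyEq hev.symm)
    refine hy.congr_deriv ?_
    have hvi : (1 / v z) ≠ 0 := one_div_ne_zero hvz
    apply mul_left_cancel₀ (mul_ne_zero two_ne_zero hvi)
    simp only [Nat.cast_ofNat, Nat.add_one_sub_one, pow_one] at h3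
    linear_combination h3
  have hds : ∀ (F : ℂ → ℂ), F 0 = 1 → ∀ z, F z = 1 + z * dslope F 0 z := by
    intro F h0 z
    have := sub_smul_dslope F 0 z
    rw [smul_eq_mul, sub_zero, h0] at this
    rw [this]; ring
  have hbn : ball (0:ℂ) r ∈ 𝓝 (0:ℂ) := ball_mem_nhds 0 hr
  have hpi : (2 * (Real.pi : ℂ) * Complex.I) ≠ 0 := Complex.two_pi_I_ne_zero
  have hcne : -(2 / ((n : ℂ) + 1)) ≠ 0 := neg_ne_zero.2 (div_ne_zero two_ne_zero hn)
  have hre2 : (2 * (Real.pi : ℂ) * Complex.I).re = 0 := by simp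
  have hre1 : ((Real.pi : ℂ) * Complex.I).re = 0 := by simp
  refine ⟨r, v, t, dslope U 0, dslope E 0, hr,
    fun z hz => (hvd z hz).differentiableAt.differentiableWithinAt,
    fun z hz => (htd z hz).differentiableAt.differentiableWithinAt,
    (Complex.differentiableOn_dslope hbn).2 kUo, (Complex.differentiableOn_dslope hbn).2 kEo,
    fun z _ => ⟨by rw [← hds U hU0], by rw [← hds E hE0]⟩,
    fun z hz h0 => ⟨hvne z hz h0, htne z hz h0, henergy z hz h0, hxd z hz h0, hyd z hz h0⟩,
    ?_, ?_, ?_⟩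
  · intro ε h0 hεr
    refine ⟨?_, ?_, ?_⟩
    · rw [wnd_aux (n + 1) _ hcne t E r kEo kEs (fun z _ => rfl) _ hre2 ε h0 hεr
        (by rw [Complex.exp_two_pi_mul_I, mul_one])]
      push_cast
      field_simp
    · rw [wnd_aux (n + 1) 1 one_ne_zero (fun z => z ^ (n + 1)) (fun _ => 1) r
        (differentiableOn_const 1) (fun _ _ => Complex.one_mem_slitPlane)
        (fun z _ => by ring) _ hre2 ε h0 hεr rfl]
      push_cast
      field_simp
    · rw [wnd_aux (n + 3) _ ha0 v U r kUo kUs (fun z _ => rfl) _ hre2 ε h0 hεr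
        (by rw [Complex.exp_two_pi_mul_I, mul_one])]
      push_cast
      field_simp
  · intro hev ε h0 hεr s₁ hs₁ s₂ hs₂ heq
    have hmem : ∀ s : ℝ, (ε : ℂ) * Complex.exp (2 * (Real.pi : ℂ) * Complex.I * (s : ℂ))
        ∈ ball (0:ℂ) r := by
      intro s
      rw [mem_ball_zero_iff, norm_mul, Complex.norm_exp, Complex.norm_real, Complex.mul_re, hre2]
      simp [abs_of_pos h0, hεr]
    have hε : (ε : ℂ) ≠ 0 := by exact_mod_cast h0.ne'
    have hne : ∀ s : ℝ, (ε : ℂ) * Complex.exp (2 * (Real.pi : ℂ) * Complex.I * (s : ℂ)) ≠ 0 :=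
      fun s => mul_ne_zero hε (Complex.exp_ne_zero _)
    obtain ⟨hv12, hw12⟩ := Prod.mk.inj heq
    have hθ : (ε : ℂ) * Complex.exp (2 * (Real.pi : ℂ) * Complex.I * (s₁ : ℂ))
        = (ε : ℂ) * Complex.exp (2 * (Real.pi : ℂ) * Complex.I * (s₂ : ℂ)) := by
      have m1 := hmem s₁
      have m2 := hmem s₂
      have n1 := hne s₁
      have n2 := hne s₂
      generalize (ε : ℂ) * Complex.exp (2 * (Real.pi : ℂ) * Complex.I * (s₁ : ℂ)) = θ₁ at *
      generalize (ε : ℂ) * Complex.exp (2 * (Real.pi : ℂ) * Complex.I * (s₂ : ℂ)) = θ₂ at *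
      have q : θ₁ ^ 2 * U θ₁ = θ₂ ^ 2 * U θ₂ := by
        have hv' : a * θ₁ ^ (n + 3) * U θ₁ = a * θ₂ ^ (n + 3) * U θ₂ := hv12
        apply mul_left_cancel₀ (mul_ne_zero ha0 (pow_ne_zero (n + 1) n1))
        have hw' : θ₁ ^ (n + 1) = θ₂ ^ (n + 1) := hw12
        calc a * θ₁ ^ (n + 1) * (θ₁ ^ 2 * U θ₁) = a * θ₁ ^ (n + 3) * U θ₁ := by ring
          _ = a * θ₂ ^ (n + 3) * U θ₂ := hv'
          _ = a * θ₂ ^ (n + 1) * (θ₂ ^ 2 * U θ₂) := by ring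
          _ = _ := by rw [hw']
      have q2 : θ₁ ^ 2 = θ₂ ^ 2 := by rw [← kψ θ₁ m1, ← kψ θ₂ m2, q]
      rcases sq_eq_sq_iff_eq_or_eq_neg.1 q2 with h | h
      · exact h
      · exfalso
        have hw' : θ₁ ^ (n + 1) = θ₂ ^ (n + 1) := hw12
        have hodd : Odd (n + 1) := by
          rcases hev with ⟨j, hj⟩
          exact ⟨j - 1, by omega⟩
        rw [h, hodd.neg_pow] at hw'
        have : θ₂ ^ (n + 1) = 0 := by linear_combination (-1/2) * hw'
        exact pow_ne_zero _ n2 this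
    have hexp := mul_left_cancel₀ hε hθ
    rw [Complex.exp_eq_exp_iff_exists_int] at hexp
    obtain ⟨j, hj⟩ := hexp
    have hj' : (s₁ : ℂ) = s₂ + j := by
      apply mul_left_cancel₀ hpi
      rw [hj]; ring
    have hj'' : s₁ = s₂ + j := by exact_mod_cast hj'
    have hj0 : j = 0 := by
      have a1 : (j : ℝ) < 1 := by linarith [hs₁.2, hs₂.1]
      have a2 : (-1 : ℝ) < j := by linarith [hs₁.1, hs₂.2]
      have b1 : j < 1 := by exact_mod_cast a1
      have b2 : -1 < j := by exact_mod_cast a2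
      omega
    simp [hj'', hj0]
  · intro hodd
    have hev1 : Even (n + 1) := by
      rcases hodd with ⟨j, hj⟩
      exact ⟨j, by omega⟩
    have hev3 : Even (n + 3) := by
      rcases hodd with ⟨j, hj⟩
      exact ⟨j + 1, by omega⟩
    refine ⟨fun z _ => ⟨?_, ?_⟩, ?_⟩
    · simp only [hv, hUev, hev3.neg_pow]
    · simp only [ht, hEev, hev1.neg_pow]
    intro ε h0 hεr
    refine ⟨?_, ?_, ?_⟩
    · rw [wnd_aux (n + 1) _ hcne t E r kEo kEs (fun z _ => rfl) _ hre1 ε h0 hεr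
        (by rw [Complex.exp_pi_mul_I, mul_neg_one, hEev])]
      push_cast
      field_simp
    · rw [wnd_aux (n + 1) 1 one_ne_zero (fun z => z ^ (n + 1)) (fun _ => 1) r
        (differentiableOn_const 1) (fun _ _ => Complex.one_mem_slitPlane)
        (fun z _ => by ring) _ hre1 ε h0 hεr rfl]
      push_cast
      field_simp
    · rw [wnd_aux (n + 3) _ ha0 v U r kUo kUs (fun z _ => rfl) _ hre1 ε h0 hεr
        (by rw [Complex.exp_pi_mul_I, mul_neg_one, hUev])]
      push_cast
      field_simp
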